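/- Under Assumptions 1 and 3 and with κ ∈ (0,1/2], consider the weighted directed graph G_R constructed from the PHPIP chain {P^ε} over the recurrent communication classes of {P^0} (which are the singletons of diag(A)). Then for every root z^l ∈ diag(A), every edge of the minimal resistance tree with root z^l over G_R belongs to E_s. -/

import Mathlib

open Filter Topology Set

attribute [local instance] Classical.propDecidable

section PHPIP

variable {ι : Type*} [Fintype ι] [DecidableEq ι] {A : ι → Type*} [∀ i, Fintype (A i)]

/-- Assumption 1 on the constraint maps. -/
def Assumption1 (C : ∀ i, A i → Finset (A i)) : Prop :=
  (∀ (i : ι) (a b : A i), b ∈ C i a ↔ a ∈ C i b) ∧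
  (∀ (i : ι) (a b : A i), ∃ (nf : ℕ) (f : ℕ → A i), f 0 = a ∧ f nf = b ∧
      ∀ k < nf, f (k + 1) ∈ C i (f k)) ∧
  (∀ (i : ι) (a : A i), 3 ≤ (C i a).card)

/-- Assumption 3: unilateral constrained deviations change the utility by less than 1/2. -/
def Assumption3 (U : ι → (∀ i, A i) → ℝ) (C : ∀ i, A i → Finset (A i)) : Prop :=
  ∀ (i : ι) (a : ∀ j, A j) (b : A i), b ∈ C i (a i) →
    U i (Function.update a i b) - U i a < 1 / 2

/-- Γ is a constrained potential game with potential function φ. -/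
def IsPotentialGame (U : ι → (∀ i, A i) → ℝ) (C : ∀ i, A i → Finset (A i))
    (φ : (∀ i, A i) → ℝ) : Prop :=
  ∀ (i : ι) (a : ∀ j, A j) (b : A i), b ∈ C i (a i) →
    U i (Function.update a i b) - U i a = φ (Function.update a i b) - φ a

/-- Probability that, from state `(a0, a1)`, player `i` selects the action `x`
under the PHPIP selection rule with exploration rate `ε` and parameter `κ`. -/
noncomputable def selProb (κ : ℝ) (U : ι → (∀ i, A i) → ℝ)
    (C : ∀ i, A i → Finset (A i)) (ε : ℝ) (a0 a1 : ∀ i, A i) (i : ι) (x : A i) : ℝ :=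
  if U i a0 ≤ U i a1 then
    (if x = a1 i then 1 - ε else 0) +
      (if x ∈ (C i (a1 i)).erase (a1 i) then
        ε / ((C i (a1 i)).erase (a1 i)).card else 0)
  else
    (if x = a1 i then (1 - ε) * (κ * ε ^ (U i a0 - U i a1)) else 0) +
      (if x = a0 i then (1 - ε) * (1 - κ * ε ^ (U i a0 - U i a1)) else 0) +
      (if x ∈ ((C i (a1 i)).erase (a1 i)).erase (a0 i) then
        ε / (((C i (a1 i)).erase (a1 i)).erase (a0 i)).card else 0)

/-- One-step transition probability of the Markov chain `{P^ε}` induced by PHPIP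
on pairs of joint actions. -/
noncomputable def phTrans (κ : ℝ) (U : ι → (∀ i, A i) → ℝ)
    (C : ∀ i, A i → Finset (A i)) (ε : ℝ)
    (z1 z2 : (∀ i, A i) × (∀ i, A i)) : ℝ :=
  if z2.1 = z1.2 then ∏ i, selProb κ U C ε z1.1 z1.2 i (z2.2 i) else 0

/-- The state space B. -/
def memB (C : ∀ i, A i → Finset (A i)) (z : (∀ i, A i) × (∀ i, A i)) : Prop :=
  ∀ i, z.2 i ∈ C i (z.1 i)

/-- k-step transition probabilities of the homogeneous chain `{P^ε}`. -/
noncomputable def phTransPow (κ : ℝ) (U : ι → (∀ i, A i) → ℝ)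
    (C : ∀ i, A i → Finset (A i)) (ε : ℝ) :
    ℕ → (∀ i, A i) × (∀ i, A i) → (∀ i, A i) × (∀ i, A i) → ℝ
  | 0, z, z' => if z = z' then 1 else 0
  | k + 1, z, z' => ∑ w : (∀ i, A i) × (∀ i, A i),
      phTrans κ U C ε z w * phTransPow κ U C ε k w z'

/-- Probability of a path (sequence of states) of the chain `{P^ε}`. -/
noncomputable def pathProb (κ : ℝ) (U : ι → (∀ i, A i) → ℝ)
    (C : ∀ i, A i → Finset (A i)) (ε : ℝ) :
    List ((∀ i, A i) × (∀ i, A i)) → ℝ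
  | [] => 1
  | [_] => 1
  | z :: z' :: rest => phTrans κ U C ε z z' * pathProb κ U C ε (z' :: rest)

/-- A transition is feasible if it has positive probability for some ε ∈ (0,1/2]. -/
def Feasible (κ : ℝ) (U : ι → (∀ i, A i) → ℝ) (C : ∀ i, A i → Finset (A i))
    (z z' : (∀ i, A i) × (∀ i, A i)) : Prop :=
  ∃ ε : ℝ, 0 < ε ∧ ε ≤ 1 / 2 ∧ 0 < phTrans κ U C ε z z'

/-- `l` is a (feasible) path of the chain from `z1` to `z2`. -/
def IsPath (κ : ℝ) (U : ι → (∀ i, A i) → ℝ) (C : ∀ i, A i → Finset (A i))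
    (z1 z2 : (∀ i, A i) × (∀ i, A i)) (l : List ((∀ i, A i) × (∀ i, A i))) : Prop :=
  l.head? = some z1 ∧ l.getLast? = some z2 ∧ l.Chain' (Feasible κ U C)

/-- `r` is the resistance of the path `l`:  `lim_{ε→0+} P^ε(l)/ε^r ∈ (0,∞)`. -/
def IsPathRes (κ : ℝ) (U : ι → (∀ i, A i) → ℝ) (C : ∀ i, A i → Finset (A i))
    (l : List ((∀ i, A i) × (∀ i, A i))) (r : ℝ) : Prop :=
  ∃ L : ℝ, 0 < L ∧
    Tendsto (fun ε : ℝ => pathProb κ U C ε l / ε ^ r) (𝓝[>] (0 : ℝ)) (𝓝 L)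

/-- `(a, b)` (as diagonal states `((a,a),(b,b))`) is a pair in `E_s`:
exactly one player deviates and the deviation is feasible. -/
def EsPair (C : ∀ i, A i → Finset (A i)) (a b : ∀ i, A i) : Prop :=
  (∃! i, a i ≠ b i) ∧ ∀ i, a i ≠ b i → b i ∈ C i (a i)

/-- The path (list of states) of the M-straight-route through the given diagonal nodes. -/
def msrPath : List (∀ i, A i) → List ((∀ i, A i) × (∀ i, A i))
  | [] => []
  | [a] => [(a, a)]
  | a :: b :: rest => (a, a) :: (a, b) :: msrPath (b :: rest)

/-- Weight of the edge of the graph `G_R` from `z` to `z'`: the minimal resistance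
among all paths of `{P^ε}` from `z` to `z'`. -/
noncomputable def edgeWeight (κ : ℝ) (U : ι → (∀ i, A i) → ℝ)
    (C : ∀ i, A i → Finset (A i)) (z z' : (∀ i, A i) × (∀ i, A i)) : ℝ :=
  sInf {r : ℝ | ∃ l, IsPath κ U C z z' l ∧ IsPathRes κ U C l r}

/-- `y` is reachable from `x` in at most `d` constraint-feasible steps. -/
def ReachIn (C : ∀ i, A i → Finset (A i)) (i : ι) : ℕ → A i → A i → Prop
  | 0, x, y => x = y
  | d + 1, x, y => ReachIn C i d x y ∨ ∃ w, ReachIn C i d x w ∧ y ∈ C i w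

/-- Inhomogeneous products: `transProd κ U C εs k0 m` is the transition matrix
`P(k0, k0 + m) = ∏_{k'=k0}^{k0+m-1} P_{k'}` of the PIPIP chain with exploration
rates `εs`. -/
noncomputable def transProd (κ : ℝ) (U : ι → (∀ i, A i) → ℝ)
    (C : ∀ i, A i → Finset (A i)) (εs : ℕ → ℝ) (k0 : ℕ) :
    ℕ → (∀ i, A i) × (∀ i, A i) → (∀ i, A i) × (∀ i, A i) → ℝ
  | 0, z, z' => if z = z' then 1 else 0
  | m + 1, z, z' => ∑ w : (∀ i, A i) × (∀ i, A i),
      transProd κ U C εs k0 m z w * phTrans κ U C (εs (k0 + m)) w z'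

/-- The PIPIP exploration rate `ε(k) = k^{-1/(n(D+1))}`. -/
noncomputable def pipipRate (n D : ℕ) (k : ℕ) : ℝ :=
  (k : ℝ) ^ (-(1 : ℝ) / ((n : ℝ) * ((D : ℝ) + 1)))

/-- Accessibility along the unperturbed chain `{P^0}`. -/
def Accessible0 (κ : ℝ) (U : ι → (∀ i, A i) → ℝ) (C : ∀ i, A i → Finset (A i))
    (z z' : (∀ i, A i) × (∀ i, A i)) : Prop :=
  ∃ k : ℕ, 0 < phTransPow κ U C 0 k z z'

/-- A recurrent communication class of the unperturbed chain `{P^0}`. -/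
def IsRecClass (κ : ℝ) (U : ι → (∀ i, A i) → ℝ) (C : ∀ i, A i → Finset (A i))
    (H : Set ((∀ i, A i) × (∀ i, A i))) : Prop :=
  H.Nonempty ∧ (∀ z ∈ H, ∀ z' ∈ H, Accessible0 κ U C z z') ∧
    (∀ z ∈ H, ∀ z', Accessible0 κ U C z z' → z' ∈ H)

end PHPIP

section EsGraph

variable {ι : Type*} [DecidableEq ι] {A : ι → Type*}

/-- The graph on joint actions whose edges are the pairs in `E_s`. -/
def esGraph (C : ∀ i, A i → Finset (A i))
    (hsymm : ∀ (i : ι) (a b : A i), b ∈ C i a ↔ a ∈ C i b) : SimpleGraph (∀ i, A i) where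
  Adj := EsPair C
  symm := ⟨by
    rintro a b ⟨⟨i, hi, hu⟩, hC⟩
    exact ⟨⟨i, Ne.symm hi, fun j hj => hu j (Ne.symm hj)⟩,
      fun j hj => (hsymm j (a j) (b j)).1 (hC j (Ne.symm hj))⟩⟩
  loopless := ⟨fun _ h => h.1.exists.elim fun _ hi => hi rfl⟩

variable {C : ∀ i, A i → Finset (A i)}
  {hsymm : ∀ (i : ι) (a b : A i), b ∈ C i a ↔ a ∈ C i b}

theorem esPair_update {a : ∀ i, A i} {i : ι} {x : A i} (hne : x ≠ a i) (hx : x ∈ C i (a i)) :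
    EsPair C a (Function.update a i x) := by
  have key : ∀ j, a j ≠ Function.update a i x j → j = i := by
    intro j hj
    by_contra h
    exact hj (by rw [Function.update_of_ne h])
  refine ⟨⟨i, by simpa using Ne.symm hne, key⟩, ?_⟩
  intro j hj
  obtain rfl := key j hj
  simpa using hx

theorem esGraph_reachable_update (hA1 : Assumption1 C) (a : ∀ i, A i) (i : ι) (x : A i) :
    (esGraph C hsymm).Reachable a (Function.update a i x) := by
  obtain ⟨n, f, h0, hn, hf⟩ := hA1.2.1 i (a i) x
  have key : ∀ k ≤ n, (esGraph C hsymm).Reachable a (Function.update a i (f k)) := by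
    intro k
    induction k with
    | zero => intro _; rw [h0, Function.update_eq_self]
    | succ k ih =>
      intro hk
      refine (ih (by omega)).trans ?_
      by_cases hne : f (k + 1) = f k
      · rw [hne]
      · have h := esPair_update (C := C) (a := Function.update a i (f k)) (i := i)
          (x := f (k + 1)) (by simpa using hne) (by simpa using hf k (by omega))
        rw [Function.update_idem] at h
        exact SimpleGraph.Adj.reachable h
  exact hn ▸ key n le_rfl

theorem esGraph_connected [Fintype ι] (hA1 : Assumption1 C) (r : ∀ i, A i) :
    (esGraph C hsymm).Connected := by
  have key : ∀ (a b : ∀ i, A i) (s : Finset ι),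
      (esGraph C hsymm).Reachable a (s.piecewise b a) := by
    intro a b s
    induction s using Finset.induction_on with
    | empty => simp
    | insert i s _ ih =>
      rw [Finset.piecewise_insert]
      exact ih.trans (esGraph_reachable_update hA1 _ _ _)
  have : Nonempty (∀ i, A i) := ⟨r⟩
  exact ⟨fun a b => by simpa using key a b Finset.univ⟩

theorem esGraph_dist_le_card (hconn : (esGraph C hsymm).Connected) (E : Finset ι) :
    ∀ x y : ∀ i, A i, (∀ i ∉ E, y i = x i) → (∀ i ∈ E, y i = x i ∨ y i ∈ C i (x i)) →
      (esGraph C hsymm).dist x y ≤ E.card := by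
  induction E using Finset.induction_on with
  | empty =>
    intro x y h _
    obtain rfl : y = x := funext fun i => h i (by simp)
    simp
  | insert i s his ih =>
    intro x y h h'
    have h1 := ih x (Function.update y i (x i))
      (fun j hj => by
        by_cases hji : j = i
        · subst hji; simp
        · rw [Function.update_of_ne hji]; exact h j (by simp [hji, hj]))
      (fun j hj => by
        have hji : j ≠ i := fun e => his (e ▸ hj)
        rw [Function.update_of_ne hji]; exact h' j (by simp [hj]))
    have h2 : (esGraph C hsymm).dist (Function.update y i (x i)) y ≤ 1 := by
      by_cases hyx : y i = x i
      · rw [← hyx, Function.update_eq_self]; simp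
      · have hC := (h' i (by simp)).resolve_left hyx
        have he := esPair_update (C := C) (a := Function.update y i (x i)) (i := i) (x := y i)
          (by simpa using hyx) (by simpa using hC)
        rw [Function.update_idem, Function.update_eq_self] at he
        exact (SimpleGraph.dist_eq_one_iff_adj.2 he).le
    rw [Finset.card_insert_of_notMem his]
    exact hconn.dist_triangle.trans (add_le_add h1 h2)

end EsGraph

section LowerBound

variable {ι : Type*} {A : ι → Type*}
  {U : ι → (∀ i, A i) → ℝ} {C : ∀ i, A i → Finset (A i)} {κ : ℝ}

theorem selProb_mem_Icc (hκ0 : 0 < κ) (hκ : κ ≤ 1 / 2) {ε : ℝ} (h0 : 0 < ε) (h1 : ε ≤ 1 / 2)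
    (a0 a1 : ∀ i, A i) (i : ι) (x : A i) :
    selProb κ U C ε a0 a1 i x ∈ Set.Icc 0 (if x ≠ a0 i ∧ x ≠ a1 i then ε else 1) := by
  have hdiv : ∀ s : Finset (A i), x ∈ s → 0 ≤ ε / s.card ∧ ε / s.card ≤ ε := by
    intro s hs
    refine ⟨by positivity, div_le_self h0.le ?_⟩
    exact_mod_cast Finset.card_pos.2 ⟨x, hs⟩
  unfold selProb
  by_cases hU : U i a0 ≤ U i a1
  · rw [if_pos hU]
    by_cases hx1 : x = a1 i
    · simp only [hx1, Finset.notMem_erase, if_true, if_false, ne_eq, not_true_eq_false, and_false]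
      constructor <;> linarith
    · by_cases hm : x ∈ (C i (a1 i)).erase (a1 i)
      · obtain ⟨h2, h3⟩ := hdiv _ hm
        simp only [hx1, hm, if_true, if_false, zero_add]
        refine ⟨h2, ?_⟩
        split_ifs <;> linarith
      · simp only [hx1, hm, if_false, zero_add]
        refine ⟨le_rfl, ?_⟩
        split_ifs <;> linarith
  · rw [if_neg hU]
    have hp0 : 0 < ε ^ (U i a0 - U i a1) := Real.rpow_pos_of_pos h0 _
    have hp1 : ε ^ (U i a0 - U i a1) ≤ 1 :=
      Real.rpow_le_one h0.le (by linarith) (by linarith)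
    have hq0 : 0 ≤ κ * ε ^ (U i a0 - U i a1) := by positivity
    have hq1 : κ * ε ^ (U i a0 - U i a1) ≤ 1 := by nlinarith
    generalize κ * ε ^ (U i a0 - U i a1) = q at hq0 hq1
    by_cases hm : x ∈ ((C i (a1 i)).erase (a1 i)).erase (a0 i)
    · obtain ⟨h2, h3⟩ := hdiv _ hm
      have hx0 : x ≠ a0 i := (Finset.mem_erase.1 hm).1
      have hx1 : x ≠ a1 i := (Finset.mem_erase.1 (Finset.mem_erase.1 hm).2).1
      simp only [hx0, hx1, hm, if_true, if_false, zero_add, ne_eq, not_false_eq_true, and_true]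
      exact ⟨h2, h3⟩
    · constructor <;> split_ifs <;> first | tauto | nlinarith

theorem mem_of_selProb_ne_zero {ε : ℝ} {a0 a1 : ∀ i, A i} {i : ι} {x : A i}
    (h : selProb κ U C ε a0 a1 i x ≠ 0) : x = a0 i ∨ x = a1 i ∨ x ∈ C i (a1 i) := by
  by_contra! hx
  apply h
  unfold selProb
  simp [hx.1, hx.2.1, hx.2.2]

variable [Fintype ι]

/-- The players whose next action is neither the current nor the previous one. -/
noncomputable def explorers (z w : (∀ i, A i) × (∀ i, A i)) : Finset ι :=
  Finset.univ.filter fun i => w.2 i ≠ z.1 i ∧ w.2 i ≠ z.2 i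

theorem phTrans_mem_Icc (hκ0 : 0 < κ) (hκ : κ ≤ 1 / 2) {ε : ℝ} (h0 : 0 < ε) (h1 : ε ≤ 1 / 2)
    (z w : (∀ i, A i) × (∀ i, A i)) :
    phTrans κ U C ε z w ∈ Set.Icc 0 (ε ^ (explorers z w).card) := by
  have h := fun i => selProb_mem_Icc (U := U) (C := C) hκ0 hκ h0 h1 z.1 z.2 i (w.2 i)
  unfold phTrans
  split_ifs
  · refine ⟨Finset.prod_nonneg fun i _ => (h i).1, ?_⟩
    refine (Finset.prod_le_prod (fun i _ => (h i).1) (fun i _ => (h i).2)).trans_eq ?_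
    rw [Finset.prod_ite, explorers]
    simp
  · exact ⟨le_rfl, by positivity⟩

theorem pathProb_nonneg (hκ0 : 0 < κ) (hκ : κ ≤ 1 / 2) {ε : ℝ} (h0 : 0 < ε) (h1 : ε ≤ 1 / 2)
    (l : List ((∀ i, A i) × (∀ i, A i))) (z : (∀ i, A i) × (∀ i, A i)) :
    0 ≤ pathProb κ U C ε (z :: l) := by
  induction l generalizing z with
  | nil => simp [pathProb]
  | cons w l ih =>
    rw [pathProb]
    exact mul_nonneg (phTrans_mem_Icc hκ0 hκ h0 h1 z w).1 (ih w)

variable [DecidableEq ι] {hsymm : ∀ (i : ι) (a b : A i), b ∈ C i a ↔ a ∈ C i b}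

/-- A feasible transition moves each mixture of the previous and current joint actions by at most
as many `E_s` steps as there are explorers. -/
theorem dist_le_of_feasible (hconn : (esGraph C hsymm).Connected)
    {z w : (∀ i, A i) × (∀ i, A i)} (hf : Feasible κ U C z w) {a : ∀ i, A i} {N : ℕ}
    (hN : ∀ y : ∀ i, A i, (∀ i, y i = z.1 i ∨ y i = z.2 i) → (esGraph C hsymm).dist a y ≤ N)
    (y : ∀ i, A i) (hy : ∀ i, y i = w.1 i ∨ y i = w.2 i) :
    (esGraph C hsymm).dist a y ≤ N + (explorers z w).card := by
  obtain ⟨ε, _, _, hpos⟩ := hf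
  unfold phTrans at hpos
  split_ifs at hpos with hzw
  swap
  · exact absurd hpos (lt_irrefl 0)
  have hsel : ∀ i, w.2 i = z.1 i ∨ w.2 i = z.2 i ∨ w.2 i ∈ C i (z.2 i) := fun i =>
    mem_of_selProb_ne_zero (Finset.prod_ne_zero_iff.1 hpos.ne' i (Finset.mem_univ i))
  rw [hzw] at hy
  have h1 := hN ((explorers z w).piecewise z.2 y) fun i => by
    by_cases hi : i ∈ explorers z w
    · simp [hi]
    · rw [Finset.piecewise_eq_of_notMem _ _ _ hi]
      simp only [explorers, Finset.mem_filter, Finset.mem_univ, true_and, not_and_or,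
        not_not] at hi
      rcases hy i with h | h
      · exact Or.inr h
      · rwa [← h] at hi
  have h2 := esGraph_dist_le_card hconn (explorers z w) ((explorers z w).piecewise z.2 y) y
    (fun i hi => by simp [hi])
    (fun i hi => by
      rw [Finset.piecewise_eq_of_mem _ _ _ hi]
      simp only [explorers, Finset.mem_filter, Finset.mem_univ, true_and] at hi
      rcases hy i with h | h
      · exact Or.inl h
      · rw [h]
        exact Or.inr (((hsel i).resolve_left hi.1).resolve_left hi.2))
  exact hconn.dist_triangle.trans (add_le_add h1 h2)

theorem pathProb_le (hκ0 : 0 < κ) (hκ : κ ≤ 1 / 2) (hconn : (esGraph C hsymm).Connected)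
    {a b : ∀ i, A i} (l : List ((∀ i, A i) × (∀ i, A i))) :
    ∀ (z : (∀ i, A i) × (∀ i, A i)) (N : ℕ),
      (∀ y : ∀ i, A i, (∀ i, y i = z.1 i ∨ y i = z.2 i) → (esGraph C hsymm).dist a y ≤ N) →
      (z :: l).getLast? = some (b, b) → (z :: l).IsChain (Feasible κ U C) →
      ∃ m : ℕ, (esGraph C hsymm).dist a b ≤ N + m ∧
        ∀ ε : ℝ, 0 < ε → ε ≤ 1 / 2 → pathProb κ U C ε (z :: l) ≤ ε ^ m := by
  induction l with
  | nil =>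
    intro z N hN hlast _
    obtain rfl : z = (b, b) := by simpa using hlast
    exact ⟨0, hN b fun i => Or.inl rfl, fun ε _ _ => by simp [pathProb]⟩
  | cons w l ih =>
    intro z N hN hlast hch
    rw [List.isChain_cons_cons] at hch
    obtain ⟨m, hm, hle⟩ := ih w _ (dist_le_of_feasible hconn hch.1 hN)
      (by simpa [List.getLast?_cons_cons] using hlast) hch.2
    refine ⟨(explorers z w).card + m, by omega, fun ε h0 h1 => ?_⟩
    rw [pathProb, pow_add]
    exact mul_le_mul (phTrans_mem_Icc hκ0 hκ h0 h1 z w).2 (hle ε h0 h1)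
      (pathProb_nonneg hκ0 hκ h0 h1 l w) (by positivity)

theorem dist_le_resistance (hκ0 : 0 < κ) (hκ : κ ≤ 1 / 2) (hconn : (esGraph C hsymm).Connected)
    {a b : ∀ i, A i} {l : List ((∀ i, A i) × (∀ i, A i))} {r : ℝ}
    (hl : IsPath κ U C (a, a) (b, b) l) (hr : IsPathRes κ U C l r) :
    ((esGraph C hsymm).dist a b : ℝ) ≤ r := by
  obtain ⟨hhead, hlast, hch⟩ := hl
  rcases l with _ | ⟨z, l⟩
  · simp at hhead
  obtain rfl : z = (a, a) := by simpa using hhead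
  obtain ⟨m, hm, hle⟩ := pathProb_le hκ0 hκ hconn (a := a) l (a, a) 0
    (fun y hy => by
      obtain rfl : y = a := funext fun i => by simpa using hy i
      simp) hlast hch
  refine (show ((esGraph C hsymm).dist a b : ℝ) ≤ m by exact_mod_cast (by omega)).trans ?_
  by_contra! hlt
  obtain ⟨L, hL, ht⟩ := hr
  have h0 : Tendsto (fun ε : ℝ => ε ^ ((m : ℝ) - r)) (𝓝[>] (0 : ℝ)) (𝓝 0) := by
    have h := (Real.continuousAt_rpow_const 0 ((m : ℝ) - r) (Or.inr (by linarith))).tendsto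
    rw [Real.zero_rpow (by linarith)] at h
    exact h.mono_left nhdsWithin_le_nhds
  have : L ≤ 0 := by
    refine le_of_tendsto_of_tendsto ht h0 ?_
    filter_upwards [Ioc_mem_nhdsGT (show (0 : ℝ) < 1 / 2 by norm_num)] with ε hε
    rw [Real.rpow_sub hε.1, Real.rpow_natCast]
    have := Real.rpow_pos_of_pos hε.1 r
    have := hle ε hε.1 hε.2
    gcongr
  linarith

end LowerBound

section UpperBound

/-- `f ε` is of exact order `ε ^ r` as `ε → 0+`. -/
def HasOrder (f : ℝ → ℝ) (r : ℝ) : Prop :=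
  ∃ L : ℝ, 0 < L ∧ Tendsto (fun ε : ℝ => f ε / ε ^ r) (𝓝[>] (0 : ℝ)) (𝓝 L)

theorem HasOrder.congr {f g : ℝ → ℝ} {r : ℝ} (hf : HasOrder f r) (h : ∀ ε, f ε = g ε) :
    HasOrder g r := by
  rwa [← funext h]

theorem HasOrder.mul {f g : ℝ → ℝ} {r s : ℝ} (hf : HasOrder f r) (hg : HasOrder g s) :
    HasOrder (fun ε => f ε * g ε) (r + s) := by
  obtain ⟨L, hL, hf⟩ := hf
  obtain ⟨M, hM, hg⟩ := hg
  refine ⟨L * M, mul_pos hL hM, (hf.mul hg).congr' ?_⟩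
  filter_upwards [self_mem_nhdsWithin] with ε hε
  rw [Real.rpow_add hε, div_mul_div_comm]

theorem HasOrder.const {c : ℝ} (hc : 0 < c) : HasOrder (fun _ => c) 0 :=
  ⟨c, hc, by simp⟩

theorem HasOrder.rpow (r : ℝ) : HasOrder (fun ε => ε ^ r) r := by
  refine ⟨1, one_pos, tendsto_const_nhds.congr' ?_⟩
  filter_upwards [self_mem_nhdsWithin] with ε hε
  rw [div_self (Real.rpow_pos_of_pos hε r).ne']

theorem HasOrder.one_sub : HasOrder (fun ε => 1 - ε) 0 := by
  refine ⟨1, one_pos, ?_⟩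
  have h : Tendsto (fun ε : ℝ => 1 - ε) (𝓝 0) (𝓝 (1 - 0)) :=
    (continuous_const.sub continuous_id).tendsto 0
  simpa using h.mono_left nhdsWithin_le_nhds

theorem HasOrder.prod {ι : Type*} (s : Finset ι) {f : ι → ℝ → ℝ} {r : ι → ℝ}
    (h : ∀ i ∈ s, HasOrder (f i) (r i)) :
    HasOrder (fun ε => ∏ i ∈ s, f i ε) (∑ i ∈ s, r i) := by
  induction s using Finset.cons_induction with
  | empty => simpa using HasOrder.const one_pos
  | cons i s hi ih =>
    simp only [Finset.prod_cons, Finset.sum_cons]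
    exact (h i (by simp)).mul (ih fun j hj => h j (by simp [hj]))

theorem HasOrder.exists_pos {f : ℝ → ℝ} {r : ℝ} (h : HasOrder f r) :
    ∃ ε : ℝ, 0 < ε ∧ ε ≤ 1 / 2 ∧ 0 < f ε := by
  obtain ⟨L, hL, h⟩ := h
  obtain ⟨ε, hpos, hε⟩ := ((h.eventually (lt_mem_nhds hL)).and
    (Ioc_mem_nhdsGT (show (0 : ℝ) < 1 / 2 by norm_num))).exists
  exact ⟨ε, hε.1, hε.2, (div_pos_iff_of_pos_right (Real.rpow_pos_of_pos hε.1 r)).1 hpos⟩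

variable {ι : Type*} {A : ι → Type*}
  {U : ι → (∀ i, A i) → ℝ} {C : ∀ i, A i → Finset (A i)} {κ : ℝ}

variable [Fintype ι]

theorem isPath_singleton (z : (∀ i, A i) × (∀ i, A i)) : IsPath κ U C z z [z] :=
  ⟨rfl, rfl, List.isChain_singleton z⟩

theorem isPathRes_singleton (z : (∀ i, A i) × (∀ i, A i)) : IsPathRes κ U C [z] 0 :=
  HasOrder.const one_pos

theorem EsPair.hasOrder_fst {a b : ∀ i, A i} (h : EsPair C a b) :
    HasOrder (fun ε => phTrans κ U C ε (a, a) (a, b)) 1 := by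
  obtain ⟨⟨i, hi, hu⟩, hC⟩ := h
  have key : ∀ j ∈ Finset.univ, HasOrder (fun ε => selProb κ U C ε a a j (b j))
      (if j = i then 1 else 0) := by
    intro j _
    split_ifs with hj
    · subst hj
      have hm : b j ∈ (C j (a j)).erase (a j) := Finset.mem_erase.2 ⟨Ne.symm hi, hC j hi⟩
      have hcard : (0 : ℝ) < ((C j (a j)).erase (a j)).card := by
        exact_mod_cast Finset.card_pos.2 ⟨_, hm⟩
      have := (HasOrder.rpow 1).mul (HasOrder.const (inv_pos.2 hcard))
      rw [add_zero] at this
      refine this.congr fun ε => ?_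
      simp only [selProb, le_refl, if_true, if_neg (Ne.symm hi), if_pos hm, zero_add,
        Real.rpow_one, div_eq_mul_inv]
    · have hab : b j = a j := by
        by_contra hne
        exact hj (hu j (Ne.symm hne))
      refine HasOrder.one_sub.congr fun ε => ?_
      simp [selProb, hab]
  simpa [phTrans] using HasOrder.prod Finset.univ key

variable [DecidableEq ι]

theorem EsPair.hasOrder_snd (hκ0 : 0 < κ) (hA1 : Assumption1 C) (hA3 : Assumption3 U C)
    {a b : ∀ i, A i} (h : EsPair C a b) :
    ∃ w < 1 / 2, HasOrder (fun ε => phTrans κ U C ε (a, b) (b, b)) w := by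
  obtain ⟨⟨i, hi, hu⟩, hC⟩ := h
  have hother : ∀ j, j ≠ i → a j = b j := fun j hj => by
    by_contra hne
    exact hj (hu j hne)
  have hΔ : U i a - U i b < 1 / 2 := by
    have := hA3 i b (a i) ((hA1.1 i _ _).1 (hC i hi))
    rwa [show Function.update b i (a i) = a from ?_] at this
    funext j
    by_cases hj : j = i
    · subst hj; simp
    · simp [hj, hother j hj]
  refine ⟨max 0 (U i a - U i b), max_lt (by norm_num) hΔ, ?_⟩
  have key : ∀ j ∈ Finset.univ, HasOrder (fun ε => selProb κ U C ε a b j (b j))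
      (if j = i then max 0 (U i a - U i b) else 0) := by
    intro j _
    by_cases hU : U j a ≤ U j b
    · have : (if j = i then max 0 (U i a - U i b) else 0) = 0 := by
        split_ifs with hj
        · subst hj; exact max_eq_left (by linarith)
        · rfl
      rw [this]
      refine HasOrder.one_sub.congr fun ε => ?_
      simp [selProb, hU]
    · split_ifs with hj
      · subst hj
        rw [max_eq_right (by linarith)]
        have := HasOrder.one_sub.mul ((HasOrder.const hκ0).mul (HasOrder.rpow (U j a - U j b)))
        rw [zero_add, zero_add] at this
        refine this.congr fun ε => ?_
        simp [selProb, hU, Ne.symm hi]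
      · refine HasOrder.one_sub.congr fun ε => ?_
        simp only [selProb, if_neg hU, hother j hj, if_true, Finset.notMem_erase, if_false]
        ring
  simpa [phTrans] using HasOrder.prod Finset.univ key

theorem EsPair.exists_path_cons (hκ0 : 0 < κ) (hA1 : Assumption1 C) (hA3 : Assumption3 U C)
    {a b : ∀ i, A i} (h : EsPair C a b) :
    ∃ w < 3 / 2, ∀ (z : (∀ i, A i) × (∀ i, A i)) (l : List ((∀ i, A i) × (∀ i, A i))) (r : ℝ),
      IsPath κ U C (b, b) z l → IsPathRes κ U C l r →
      ∃ l', IsPath κ U C (a, a) z l' ∧ IsPathRes κ U C l' (w + r) := by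
  have h1 : HasOrder (fun ε => phTrans κ U C ε (a, a) (a, b)) 1 := h.hasOrder_fst
  obtain ⟨w, hw, h2⟩ := h.hasOrder_snd (U := U) hκ0 hA1 hA3
  refine ⟨1 + w, by linarith, fun z l r hl hr => ?_⟩
  obtain ⟨hhead, hlast, hch⟩ := hl
  rcases l with _ | ⟨y, l⟩
  · simp at hhead
  obtain rfl : y = (b, b) := by simpa using hhead
  refine ⟨(a, a) :: (a, b) :: (b, b) :: l, ⟨rfl, ?_, ?_⟩, ?_⟩
  · simpa [List.getLast?_cons_cons] using hlast
  · exact List.isChain_cons_cons.2 ⟨h1.exists_pos, List.isChain_cons_cons.2 ⟨h2.exists_pos, hch⟩⟩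
  · exact ((h1.mul h2).mul hr).congr fun ε => by simp only [pathProb]; ring

variable {hsymm : ∀ (i : ι) (a b : A i), b ∈ C i a ↔ a ∈ C i b}

theorem EsPair.edgeWeight_lt (hκ0 : 0 < κ) (hκ : κ ≤ 1 / 2) (hA1 : Assumption1 C)
    (hA3 : Assumption3 U C) {a b : ∀ i, A i} (h : EsPair C a b) :
    edgeWeight κ U C (a, a) (b, b) < 3 / 2 := by
  obtain ⟨w, hw, hcons⟩ := h.exists_path_cons (U := U) hκ0 hA1 hA3
  obtain ⟨l, hl, hr⟩ := hcons _ _ _ (isPath_singleton (b, b)) (isPathRes_singleton (b, b))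
  have hbdd : BddBelow {r : ℝ | ∃ l, IsPath κ U C (a, a) (b, b) l ∧ IsPathRes κ U C l r} :=
    ⟨((esGraph C hA1.1).dist a b : ℝ), fun r ⟨_, hl, hr⟩ =>
      dist_le_resistance hκ0 hκ (esGraph_connected hA1 a) hl hr⟩
  have hle : edgeWeight κ U C (a, a) (b, b) ≤ w + 0 := csInf_le hbdd ⟨l, hl, hr⟩
  linarith

theorem dist_le_edgeWeight (hκ0 : 0 < κ) (hκ : κ ≤ 1 / 2) (hA1 : Assumption1 C)
    (hA3 : Assumption3 U C) (a b : ∀ i, A i) :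
    ((esGraph C hsymm).dist a b : ℝ) ≤ edgeWeight κ U C (a, a) (b, b) := by
  have hconn : (esGraph C hsymm).Connected := esGraph_connected hA1 a
  refine le_csInf ?_ fun r ⟨l, hl, hr⟩ => dist_le_resistance hκ0 hκ hconn hl hr
  obtain ⟨p⟩ := hconn.preconnected a b
  induction p with
  | nil => exact ⟨0, _, isPath_singleton _, isPathRes_singleton _⟩
  | cons hadj _ ih =>
    obtain ⟨r, l, hl, hr⟩ := ih
    obtain ⟨w, _, hcons⟩ := EsPair.exists_path_cons (U := U) hκ0 hA1 hA3 hadj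
    exact ⟨_, hcons _ _ _ hl hr⟩

end UpperBound

section Trees

/-- In a tree with parent map `T` rooted at `root`, replace the out-edges along an iteration path
`a, nxt a, …` of a map `nxt` leading from `a` to its parent, up to the first exit from the subtree
above `a`. The result is again a tree, and only nonroot vertices of the path change parents. -/
theorem exists_rerouted_tree {V : Type*} {T nxt : V → V} {root a : V} {m : ℕ}
    (hTroot : T root = root) (hTspan : ∀ c, ∃ k, T^[k] c = root) (ha : a ≠ root)
    (hm : nxt^[m] a = T a) :
    ∃ (P : Finset V) (T' : V → V), a ∈ P ∧ P.card ≤ m ∧ root ∉ P ∧ T a ∉ P ∧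
      (∀ c ∈ P, T' c = nxt c) ∧ (∀ c ∉ P, T' c = T c) ∧ ∀ c, ∃ k, T'^[k] c = root := by
  have hroot : ∀ n, T^[n] root = root := fun n => Function.iterate_fixed hTroot n
  have hS : ∀ {c}, (¬ ∃ n, T^[n] c = a) → ¬ ∃ n, T^[n] (T c) = a :=
    fun {c} h ⟨n, hn⟩ => h ⟨n + 1, by rwa [Function.iterate_succ_apply]⟩
  have hrootS : ¬ ∃ n, T^[n] root = a := fun ⟨n, hn⟩ => ha (by rw [← hn, hroot])
  have hTa : ¬ ∃ n, T^[n] (T a) = a := by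
    rintro ⟨n, hn⟩
    rw [← Function.iterate_succ_apply] at hn
    obtain ⟨k, hk⟩ := hTspan a
    have h1 : T^[(n + 1) * k] a = a := by
      rw [Function.iterate_mul]
      exact Function.iterate_fixed hn k
    apply ha
    rw [← h1, show (n + 1) * k = n * k + k by ring, Function.iterate_add_apply, hk, hroot]
  have hex : ∃ k, ¬ ∃ n, T^[n] (nxt^[k] a) = a := ⟨m, by rwa [hm]⟩
  set K := Nat.find hex
  have hKspec : ¬ ∃ n, T^[n] (nxt^[K] a) = a := Nat.find_spec hex
  have hKmin : ∀ j < K, ∃ n, T^[n] (nxt^[j] a) = a := fun j hj => not_not.1 (Nat.find_min hex hj)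
  have hKm : K ≤ m := Nat.find_min' hex (by rwa [hm])
  have hKpos : 0 < K := by
    rw [Nat.pos_iff_ne_zero]
    intro h0
    rw [h0] at hKspec
    exact hKspec ⟨0, rfl⟩
  set P : Finset V := (Finset.range K).image fun j => nxt^[j] a with hP
  have hPmem : ∀ c, c ∈ P ↔ ∃ j < K, nxt^[j] a = c := fun c => by simp [hP]
  have hPS : ∀ c ∈ P, ∃ n, T^[n] c = a := by
    intro c hc
    obtain ⟨j, hj, rfl⟩ := (hPmem c).1 hc
    exact hKmin j hj
  set T' : V → V := fun c => if c ∈ P then nxt c else T c with hT'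
  have hstep : ∀ c, (∃ k, T'^[k] (T' c) = root) → ∃ k, T'^[k] c = root :=
    fun c ⟨k, hk⟩ => ⟨k + 1, by rwa [Function.iterate_succ_apply]⟩
  have hout : ∀ k c, T^[k] c = root → (¬ ∃ n, T^[n] c = a) → ∃ k, T'^[k] c = root := by
    intro k
    induction k with
    | zero => exact fun c hc _ => ⟨0, hc⟩
    | succ k ih =>
      intro c hc hcS
      apply hstep
      rw [hT']
      simp only [if_neg fun h => hcS (hPS c h)]
      exact ih (T c) hc (hS hcS)
  have hpath : ∀ d j, j + d = K → ∃ k, T'^[k] (nxt^[j] a) = root := by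
    intro d
    induction d with
    | zero =>
      intro j hj
      rw [show j = K from hj]
      obtain ⟨k, hk⟩ := hTspan (nxt^[K] a)
      exact hout k _ hk hKspec
    | succ d ih =>
      intro j hj
      apply hstep
      have : T' (nxt^[j] a) = nxt^[j + 1] a := by
        rw [Function.iterate_succ_apply', hT']
        exact if_pos ((hPmem _).2 ⟨j, by omega, rfl⟩)
      rw [this]
      exact ih (j + 1) (by omega)
  refine ⟨P, T', (hPmem a).2 ⟨0, hKpos, rfl⟩, ?_, fun h => hrootS (hPS _ h), fun h => hTa (hPS _ h),
    fun c hc => if_pos hc, fun c hc => if_neg hc, ?_⟩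
  · exact Finset.card_image_le.trans (by simpa using hKm)
  · intro c
    obtain ⟨k, hk⟩ := hTspan c
    induction k generalizing c with
    | zero => exact ⟨0, hk⟩
    | succ k ih =>
      by_cases hc : c ∈ P
      · obtain ⟨j, hj, rfl⟩ := (hPmem c).1 hc
        exact hpath (K - j) j (by omega)
      · apply hstep
        rw [hT']
        simp only [if_neg hc]
        exact ih (T c) hk

/-- In a connected graph some map decreases the distance to `b` along its iterates. -/
theorem SimpleGraph.Connected.exists_next {V : Type*} {G : SimpleGraph V} (hG : G.Connected)
    (b : V) :
    ∃ nxt : V → V, (∀ c, c ≠ b → G.Adj c (nxt c)) ∧ ∀ c, ∀ j ≤ G.dist c b,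
      G.dist (nxt^[j] c) b + j = G.dist c b := by
  have h : ∀ c, ∃ d, c ≠ b → G.Adj c d ∧ G.dist d b + 1 = G.dist c b := by
    intro c
    by_cases hcb : c = b
    · exact ⟨c, fun h => absurd hcb h⟩
    obtain ⟨p, hp⟩ := hG.exists_walk_length_eq_dist c b
    cases p with
    | nil => exact absurd rfl hcb
    | cons hadj q =>
      refine ⟨_, fun _ => ⟨hadj, ?_⟩⟩
      have h1 := SimpleGraph.dist_le q
      have h2 := hG.dist_triangle.trans
        (add_le_add (SimpleGraph.dist_eq_one_iff_adj.2 hadj).le (le_refl (G.dist _ b)))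
      rw [SimpleGraph.Walk.length_cons] at hp
      omega
  choose nxt hnxt using h
  refine ⟨nxt, fun c hc => (hnxt c hc).1, fun c j => ?_⟩
  induction j with
  | zero => intro _; rfl
  | succ j ih =>
    intro hj
    have hi := ih (by omega)
    have hne : nxt^[j] c ≠ b := by
      intro h
      rw [h, SimpleGraph.dist_self] at hi
      omega
    rw [Function.iterate_succ_apply']
    have := (hnxt _ hne).2
    omega

end Trees

section Theorems

variable {ι : Type*} [Fintype ι] [DecidableEq ι] {A : ι → Type*} [∀ i, Fintype (A i)]

theorem statement12
    (U : ι → (∀ i, A i) → ℝ) (C : ∀ i, A i → Finset (A i))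
    (κ : ℝ) (hκ0 : 0 < κ) (hκ : κ ≤ 1 / 2)
    (hA1 : Assumption1 C) (hA3 : Assumption3 U C)
    (root : ∀ i, A i) (T : (∀ i, A i) → (∀ i, A i))
    (hTroot : T root = root) (hTspan : ∀ a, ∃ k : ℕ, T^[k] a = root)
    (hmin : ∀ T' : (∀ i, A i) → (∀ i, A i), T' root = root →
      (∀ a, ∃ k : ℕ, T'^[k] a = root) →
      (∑ a : ∀ i, A i, if a = root then 0 else edgeWeight κ U C (a, a) (T a, T a)) ≤
        ∑ a : ∀ i, A i, if a = root then 0 else edgeWeight κ U C (a, a) (T' a, T' a)) :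
    ∀ a : ∀ i, A i, a ≠ root → EsPair C a (T a) := by
  intro a ha
  by_contra hEs
  set G := esGraph C hA1.1
  have hG : G.Connected := esGraph_connected hA1 root
  have hTne : ∀ c, c ≠ root → T c ≠ c := by
    intro c hc h
    obtain ⟨k, hk⟩ := hTspan c
    exact hc (by rw [← hk, Function.iterate_fixed h])
  have hlow : ∀ c d, (G.dist c d : ℝ) ≤ edgeWeight κ U C (c, c) (d, d) :=
    fun c d => dist_le_edgeWeight hκ0 hκ hA1 hA3 c d
  have hm2 : 2 ≤ G.dist a (T a) := by
    have h0 := hG.pos_dist_of_ne (hTne a ha).symm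
    have h1 : G.dist a (T a) ≠ 1 := fun h => hEs (SimpleGraph.dist_eq_one_iff_adj.1 h)
    omega
  obtain ⟨nxt, hadj, hdist⟩ := hG.exists_next (T a)
  have hm : nxt^[G.dist a (T a)] a = T a := by
    have := hdist a _ le_rfl
    exact hG.dist_eq_zero_iff.1 (by omega)
  obtain ⟨P, T', haP, hcard, hrP, hTaP, hT'P, hT', hspan⟩ := exists_rerouted_tree hTroot hTspan ha hm
  have hle := hmin _ ((hT' root hrP).trans hTroot) hspan
  refine absurd hle (not_le.2 ?_)
  rw [← sub_pos, ← Finset.sum_sub_distrib]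
  have hzero : ∀ c ∈ Finset.univ, c ∉ P →
      ((if c = root then 0 else edgeWeight κ U C (c, c) (T c, T c)) -
        if c = root then 0 else edgeWeight κ U C (c, c) (T' c, T' c)) = 0 := by
    intro c _ hc
    simp only [hT' c hc, sub_self]
  rw [← Finset.sum_subset (Finset.subset_univ P) hzero, ← Finset.add_sum_erase _ _ haP]
  have hnew : ∀ c ∈ P, edgeWeight κ U C (c, c) (nxt c, nxt c) < 3 / 2 := fun c hc =>
    EsPair.edgeWeight_lt hκ0 hκ hA1 hA3 (hadj c fun h => hTaP (h ▸ hc))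
  have hrest : (P.erase a).card • (-(1 / 2) : ℝ) ≤ ∑ c ∈ P.erase a,
      ((if c = root then 0 else edgeWeight κ U C (c, c) (T c, T c)) -
        if c = root then 0 else edgeWeight κ U C (c, c) (T' c, T' c)) := by
    refine Finset.card_nsmul_le_sum _ _ _ fun c hc => ?_
    have hcP := Finset.mem_of_mem_erase hc
    have hcr : c ≠ root := fun h => hrP (h ▸ hcP)
    have h1 : (1 : ℝ) ≤ G.dist c (T c) := by
      exact_mod_cast hG.pos_dist_of_ne (hTne c hcr).symm
    simp only [if_neg hcr, hT'P c hcP]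
    linarith [hlow c (T c), hnew c hcP]
  simp only [if_neg ha, hT'P a haP]
  rw [Finset.card_erase_of_mem haP, nsmul_eq_mul,
    Nat.cast_sub (Finset.card_pos.2 ⟨a, haP⟩)] at hrest
  have h3 : (P.card : ℝ) ≤ G.dist a (T a) := by exact_mod_cast hcard
  have h4 : (2 : ℝ) ≤ G.dist a (T a) := by exact_mod_cast hm2
  push_cast at hrest
  linarith [hlow a (T a), hnew a haP]


end Theorems
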